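/- For every odd n ≥ 7, the sequence π = ((n−1)^2, 4, 3^{n−3}) (two terms equal to n−1, one term equal to 4, and n−3 terms equal to 3) is not potentially K6−C5-graphic. -/

import Mathlib

/-- The degree of vertex `i` in the simple graph `G`. -/
noncomputable def degCount {n : ℕ} (G : SimpleGraph (Fin n)) (i : Fin n) : ℕ :=
  {j | G.Adj i j}.ncard

/-- The graph `K₆ − C₅`: the complete graph on 6 vertices minus the edges of a
cycle on 5 of its vertices.  Vertex `0` is adjacent to all other vertices, and the
vertices `1,…,5` carry the complement of a 5-cycle (which is again a 5-cycle).
Its degree sequence is `(5,3,3,3,3,3)`. -/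
def K6C5 : SimpleGraph (Fin 6) :=
  SimpleGraph.fromRel (fun a b =>
    a = 0 ∨ b = 0 ∨
      (a, b) ∈ ([(1, 3), (3, 5), (5, 2), (2, 4), (4, 1)] : List (Fin 6 × Fin 6)))

/-- A list of natural numbers is graphic if it is the degree sequence of some
simple graph. -/
def IsGraphic (l : List ℕ) : Prop :=
  ∃ G : SimpleGraph (Fin l.length), ∀ i : Fin l.length, degCount G i = l.get i

/-- A list of natural numbers is potentially `K₆ − C₅`-graphic if it has a
realization containing `K₆ − C₅` as a subgraph. -/
def PotentiallyK6C5 (l : List ℕ) : Prop :=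
  ∃ G : SimpleGraph (Fin l.length),
    (∀ i : Fin l.length, degCount G i = l.get i) ∧
    ∃ f : Fin 6 → Fin l.length, Function.Injective f ∧
      ∀ a b : Fin 6, K6C5.Adj a b → G.Adj (f a) (f b)

/-- A vertex of degree `n - 1` is adjacent to every other vertex. -/
theorem adj_of_degCount_eq {n : ℕ} {G : SimpleGraph (Fin n)} {i j : Fin n}
    (h : degCount G i = n - 1) (hij : i ≠ j) : G.Adj i j := by
  have hsub : {k | G.Adj i k} ⊆ ({i}ᶜ : Set (Fin n)) := fun k hk => by
    simpa using (G.ne_of_adj hk).symm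
  have hcard : ({i}ᶜ : Set (Fin n)).ncard ≤ {k | G.Adj i k}.ncard := by
    rw [Set.ncard_compl, Set.ncard_singleton, Nat.card_eq_fintype_card, Fintype.card_fin]
    exact h.ge
  have heq := Set.eq_of_subset_of_ncard_le hsub hcard
  have hj : j ∈ ({i}ᶜ : Set (Fin n)) := by simpa using hij.symm
  rw [← heq] at hj
  exact hj

/-- A vertex with four distinct neighbours has degree at least `4`. -/
theorem four_le_degCount {n : ℕ} {G : SimpleGraph (Fin n)} {v : Fin n} {s : Finset (Fin n)}
    (hs : s.card = 4) (hadj : ∀ w ∈ s, G.Adj v w) : 4 ≤ degCount G v := by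
  rw [← hs, ← Set.ncard_coe_finset]
  exact Set.ncard_le_ncard hadj

instance : DecidableRel K6C5.Adj := fun a b =>
  inferInstanceAs (Decidable (a ≠ b ∧ (_ ∨ _)))

/-- After deleting any two vertices of `K₆ − C₅`, two vertices of degree at least `2` remain. -/
theorem K6C5_delete_two : ∀ x y : Fin 6, ∃ a b : Fin 6, a ≠ b ∧
    ∀ v, v = a ∨ v = b → v ≠ x ∧ v ≠ y ∧ ∃ c d : Fin 6, c ≠ d ∧ c ≠ x ∧ c ≠ y ∧ d ≠ x ∧ d ≠ y ∧
      K6C5.Adj v c ∧ K6C5.Adj v d := by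
  decide

/-- An injective map takes a given value at most once. -/
theorem Function.Injective.exists_forall_ne {α β : Type*} [Nonempty α] {f : α → β}
    (hf : Function.Injective f) (z : β) : ∃ x, ∀ a, a ≠ x → f a ≠ z := by
  by_cases h : ∃ x, f x = z
  · obtain ⟨x, rfl⟩ := h
    exact ⟨x, fun a ha => hf.ne ha⟩
  · push Not at h
    exact ⟨Classical.arbitrary α, fun a _ => h a⟩

/-- If two vertices dominate a graph and all but one of the remaining vertices have degree less
than `4`, then the graph does not contain `K₆ − C₅`. -/
theorem not_contains_K6C5 {n : ℕ} {G : SimpleGraph (Fin n)} {p q r : Fin n} (hpq : p ≠ q)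
    (hp : degCount G p = n - 1) (hq : degCount G q = n - 1)
    (hlt : ∀ v, v ≠ p → v ≠ q → v ≠ r → degCount G v < 4)
    {f : Fin 6 → Fin n} (hf : Function.Injective f)
    (hadj : ∀ a b : Fin 6, K6C5.Adj a b → G.Adj (f a) (f b)) : False := by
  obtain ⟨x, hx⟩ := hf.exists_forall_ne p
  obtain ⟨y, hy⟩ := hf.exists_forall_ne q
  obtain ⟨a, b, hab, h⟩ := K6C5_delete_two x y
  have hr : ∀ v, v = a ∨ v = b → f v = r := by
    intro v hv
    by_contra hvr
    obtain ⟨hvx, hvy, c, d, hcd, hcx, hcy, hdx, hdy, hvc, hvd⟩ := h v hv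
    have hcard : ({p, q, f c, f d} : Finset (Fin n)).card = 4 := by
      simp [Finset.card_insert_of_notMem, hpq, hf.ne hcd, (hx c hcx).symm, (hx d hdx).symm,
        (hy c hcy).symm, (hy d hdy).symm]
    refine (hlt _ (hx v hvx) (hy v hvy) hvr).not_ge (four_le_degCount hcard ?_)
    intro w hw
    simp only [Finset.mem_insert, Finset.mem_singleton] at hw
    rcases hw with rfl | rfl | rfl | rfl
    · exact (adj_of_degCount_eq hp (hx v hvx).symm).symm
    · exact (adj_of_degCount_eq hq (hy v hvy).symm).symm
    · exact hadj _ _ hvc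
    · exact hadj _ _ hvd
  exact hab (hf ((hr a (.inl rfl)).trans (hr b (.inr rfl)).symm))

theorem cond6_necessary (n : ℕ) (hn : 7 ≤ n) (hodd : Odd n) :
    ¬ PotentiallyK6C5 ((n - 1) :: (n - 1) :: 4 :: List.replicate (n - 3) 3) := by
  rintro ⟨G, hG, f, hf, hadj⟩
  have hlen : ((n - 1) :: (n - 1) :: 4 :: List.replicate (n - 3) 3).length = n := by
    simp only [List.length_cons, List.length_replicate]
    omega
  refine not_contains_K6C5 (p := ⟨0, by omega⟩) (q := ⟨1, by omega⟩) (r := ⟨2, by omega⟩)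
    (by simp) ?_ ?_ ?_ hf hadj
  · exact (hG _).trans (congrArg (· - 1) hlen.symm)
  · exact (hG _).trans (congrArg (· - 1) hlen.symm)
  · rintro ⟨v, hv⟩ h0 h1 h2
    rw [hG]
    match v, hv with
    | 0, _ => exact absurd rfl h0
    | 1, _ => exact absurd rfl h1
    | 2, _ => exact absurd rfl h2
    | v + 3, _ => simp
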